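/- arXiv:1404.5876 — 3 statements merged into one kernel-verified Lean document; each statement's English description precedes it below -/
import Mathlib

section
/- Let N be a separable real normed space and let N' denote its topological dual endowed with the weak-star topology. Then there exists a continuous surjection from ℝ onto N'; moreover, N' is a σ-Peano space. -/
/-- A Peano space: a nonempty compact, connected, locally connected, metrizable
topological space. -/
def IsPeanoSpace (X : Type*) [TopologicalSpace X] : Prop :=
  Nonempty X ∧ CompactSpace X ∧ ConnectedSpace X ∧ LocallyConnectedSpace X ∧
    TopologicalSpace.MetrizableSpace X

/-- A σ-Peano space: an increasing sequence of subsets, each a Peano space with the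
subspace topology, whose union is the whole space. -/
def IsSigmaPeano (X : Type*) [TopologicalSpace X] : Prop :=
  ∃ K : ℕ → Set X, Monotone K ∧ (∀ n, IsPeanoSpace (K n)) ∧ (⋃ n, K n) = Set.univ

open Set Topology

section CubeProjection

/-- Weighted squared distance between a point of the Hilbert cube and the (rescaled) coordinates
of a point `x` with respect to a sequence of functions `b`. -/
noncomputable def weightedSqDist {X : Type*} (b : ℕ → X → ℝ) (q : ℕ → unitInterval) (x : X) : ℝ :=
  ∑' i, (1 / 2 : ℝ) ^ i * ((q i : ℝ) - b i x) ^ 2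

variable {X : Type*} {b : ℕ → X → ℝ}

lemma weightedSqDist_term_le {q : ℕ → unitInterval} {x : X} (hb : ∀ i, b i x ∈ Icc (0 : ℝ) 1)
    (i : ℕ) : ‖(1 / 2 : ℝ) ^ i * ((q i : ℝ) - b i x) ^ 2‖ ≤ (1 / 2 : ℝ) ^ i := by
  have h0 : (0 : ℝ) < (1 / 2) ^ i := by positivity
  have hq := (q i).2
  have hx := hb i
  rw [Real.norm_of_nonneg (by positivity)]
  have : ((q i : ℝ) - b i x) ^ 2 ≤ 1 := by
    rw [sq_le_one_iff_abs_le_one, abs_le]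
    constructor <;> linarith [hq.1, hq.2, hx.1, hx.2]
  nlinarith

lemma summable_weightedSqDist (q : ℕ → unitInterval) {x : X}
    (hb : ∀ i, b i x ∈ Icc (0 : ℝ) 1) :
    Summable fun i ↦ (1 / 2 : ℝ) ^ i * ((q i : ℝ) - b i x) ^ 2 :=
  .of_norm_bounded summable_geometric_two (weightedSqDist_term_le hb)

lemma continuous_weightedSqDist [TopologicalSpace X] (hc : ∀ i, Continuous (b i))
    (hb : ∀ i x, b i x ∈ Icc (0 : ℝ) 1) :
    Continuous fun p : (ℕ → unitInterval) × X ↦ weightedSqDist b p.1 p.2 := by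
  refine continuous_tsum (fun i ↦ ?_) summable_geometric_two
    fun i p ↦ weightedSqDist_term_le (fun i ↦ hb i p.2) i
  have := hc i
  fun_prop

/-- A coordinatewise midpoint of two points with different coordinates cannot be at least as far
from `q` as both of them, so minimizers of `weightedSqDist b q` are unique. -/
lemma weightedSqDist_midpoint_lt (hb : ∀ i x, b i x ∈ Icc (0 : ℝ) 1) (q : ℕ → unitInterval)
    {x y m : X} (hm : ∀ i, b i m = (b i x + b i y) / 2) {j : ℕ} (hj : b j x ≠ b j y) :
    weightedSqDist b q m < (weightedSqDist b q x + weightedSqDist b q y) / 2 := by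
  have hx := summable_weightedSqDist q (hb · x)
  have hy := summable_weightedSqDist q (hb · y)
  have key : ∀ i, (1 / 2 : ℝ) ^ i * ((q i : ℝ) - b i m) ^ 2 =
      ((1 / 2 : ℝ) ^ i * ((q i : ℝ) - b i x) ^ 2 + (1 / 2 : ℝ) ^ i * ((q i : ℝ) - b i y) ^ 2) / 2
        - (1 / 2 : ℝ) ^ i * (b i x - b i y) ^ 2 / 4 := fun i ↦ by
    rw [hm]; ring
  unfold weightedSqDist
  rw [← hx.tsum_add hy, ← tsum_div_const]
  refine Summable.tsum_lt_tsum (i := j) (fun i ↦ ?_) ?_ (summable_weightedSqDist q (hb · m))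
    ((hx.add hy).div_const 2)
  · rw [key]
    have : 0 ≤ (1 / 2 : ℝ) ^ i * (b i x - b i y) ^ 2 := by positivity
    linarith
  · rw [key]
    have : 0 < (1 / 2 : ℝ) ^ j * (b j x - b j y) ^ 2 := by
      have := sub_ne_zero.2 hj
      positivity
    linarith

/-- A compact space with a separating sequence of continuous coordinates in `[0, 1]` which admits
coordinatewise midpoints is a continuous image of the Hilbert cube (via nearest-point
projection). -/
theorem exists_continuous_surjective_of_midpoints [TopologicalSpace X] [CompactSpace X]
    [Nonempty X] (hc : ∀ i, Continuous (b i)) (hb : ∀ i x, b i x ∈ Icc (0 : ℝ) 1)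
    (hsep : ∀ x y, (∀ i, b i x = b i y) → x = y)
    (hmid : ∀ x y, ∃ m, ∀ i, b i m = (b i x + b i y) / 2) :
    ∃ P : (ℕ → unitInterval) → X, Continuous P ∧ Function.Surjective P := by
  have hΦ := continuous_weightedSqDist hc hb
  have hmin : ∀ q, ∃ x, ∀ y, weightedSqDist b q x ≤ weightedSqDist b q y := fun q ↦ by
    have : Continuous fun x ↦ weightedSqDist b q x := hΦ.comp (Continuous.prodMk_right q)
    obtain ⟨x, -, hx⟩ := isCompact_univ.exists_isMinOn univ_nonempty this.continuousOn
    exact ⟨x, fun y ↦ hx (mem_univ y)⟩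
  choose P hP using hmin
  have huniq : ∀ q x, (∀ y, weightedSqDist b q x ≤ weightedSqDist b q y) → P q = x := by
    intro q x hx
    refine hsep _ _ fun j ↦ ?_
    by_contra hj
    obtain ⟨m, hm⟩ := hmid (P q) x
    have := weightedSqDist_midpoint_lt hb q hm hj
    linarith [hP q m, hx m]
  refine ⟨P, continuous_iff_isClosed.2 fun C hC ↦ ?_, fun x ↦ ?_⟩
  · have hΓ : IsClosed {p : (ℕ → unitInterval) × X |
        ∀ y, weightedSqDist b p.1 p.2 ≤ weightedSqDist b p.1 y} := by
      simp only [ofPred_forall]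
      exact isClosed_iInter fun y ↦ isClosed_le hΦ
        (hΦ.comp (continuous_fst.prodMk continuous_const))
    convert isClosedMap_fst_of_compactSpace _ (hΓ.inter (hC.preimage continuous_snd)) using 1
    ext q
    constructor
    · exact fun hq ↦ ⟨(q, P q), ⟨hP q, hq⟩, rfl⟩
    · rintro ⟨⟨q, x⟩, ⟨hx, hxC⟩, rfl⟩
      rw [mem_preimage, huniq q x hx]
      exact hxC
  · refine ⟨fun i ↦ ⟨b i x, hb i x⟩, huniq _ _ fun y ↦ ?_⟩
    have : weightedSqDist b (fun i ↦ ⟨b i x, hb i x⟩) x = 0 := by simp [weightedSqDist]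
    rw [this]
    exact tsum_nonneg fun i ↦ by positivity

end CubeProjection

/-- The translates `2n + C` of the Cantor set form a closed copy of `ℕ × C` in the line. -/
lemma isClosedEmbedding_translates_cantorSet :
    IsClosedEmbedding fun p : ℕ × cantorSet ↦ 2 * (p.1 : ℝ) + p.2 := by
  have : CompactSpace cantorSet := isCompact_iff_compactSpace.1 isCompact_cantorSet
  have hanti : AntilipschitzWith 1 fun p : ℕ × cantorSet ↦ 2 * (p.1 : ℝ) + p.2 := by
    refine AntilipschitzWith.of_le_mul_dist fun ⟨n, x⟩ ⟨m, y⟩ ↦ ?_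
    have hx := cantorSet_subset_unitInterval x.2
    have hy := cantorSet_subset_unitInterval y.2
    have hxy : |(x : ℝ) - y| ≤ 1 := by
      rw [abs_le]; constructor <;> linarith [hx.1, hx.2, hy.1, hy.2]
    simp only [NNReal.coe_one, one_mul, Prod.dist_eq, Subtype.dist_eq, Real.dist_eq, Nat.dist_eq]
    rcases eq_or_ne n m with rfl | hnm
    · simp
    · have h1 : (1 : ℝ) ≤ |(n : ℝ) - m| := by
        have : (1 : ℤ) ≤ |(n : ℤ) - m| := Int.one_le_abs (sub_ne_zero.2 (by exact_mod_cast hnm))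
        exact_mod_cast this
      have h2 : 2 * |(n : ℝ) - m| - |(x : ℝ) - y| ≤ |2 * (n : ℝ) + x - (2 * m + y)| := by
        have := abs_sub_abs_le_abs_sub (2 * ((n : ℝ) - m)) (y - x)
        rw [abs_mul, abs_two, abs_sub_comm (y : ℝ)] at this
        have h3 : 2 * (n : ℝ) + x - (2 * m + y) = 2 * ((n : ℝ) - m) - (y - x) := by ring
        rwa [h3]
      exact max_le (by linarith) (by linarith)
  refine hanti.isClosedEmbedding ?_
  have h1 : UniformContinuous fun n : ℕ ↦ (n : ℝ) :=
    Nat.isUniformEmbedding_coe_real.uniformContinuous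
  exact ((h1.comp uniformContinuous_fst).const_mul' 2).add
    (uniformContinuous_subtype_val.comp uniformContinuous_snd)

/-- There is a curve in `ℝ × [0,1]^ℕ` passing through every point of `ℕ × [0,1]^ℕ`. -/
lemma exists_continuous_curve_real_prod_cube :
    ∃ g : ℝ → ℝ × (ℕ → unitInterval), Continuous g ∧ ∀ (n : ℕ) q, ∃ t, g t = ((n : ℝ), q) := by
  let f : C(ℕ × cantorSet, ℝ × (ℕ → unitInterval)) :=
    ⟨fun p ↦ ((p.1 : ℝ), cantorToHilbert (cantorSetHomeomorphNatToBool p.2)), by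
      have := cantorToHilbert_continuous
      fun_prop⟩
  obtain ⟨g, hg⟩ := f.exists_extension' isClosedEmbedding_translates_cantorSet
  refine ⟨g, g.continuous, fun n q ↦ ?_⟩
  obtain ⟨c, rfl⟩ := cantorToHilbert_surjective q
  refine ⟨2 * (n : ℝ) + cantorSetHomeomorphNatToBool.symm c, ?_⟩
  simpa [f] using congrFun hg (n, cantorSetHomeomorphNatToBool.symm c)

namespace WeakDual

variable (N : Type*) [NormedAddCommGroup N] [NormedSpace ℝ N]

/-- The closed ball of radius `r` around `0` in the dual, as a subset of the weak dual. -/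
def normBall (r : ℝ) : Set (WeakDual ℝ N) :=
  toStrongDual ⁻¹' Metric.closedBall (0 : StrongDual ℝ N) r

variable {N}

lemma mem_normBall {r : ℝ} {x : WeakDual ℝ N} : x ∈ normBall N r ↔ ‖toStrongDual x‖ ≤ r := by
  simp [normBall]

lemma convex_normBall (r : ℝ) : Convex ℝ (normBall N r) :=
  (convex_closedBall (0 : StrongDual ℝ N) r).linear_preimage
    (toStrongDual : WeakDual ℝ N ≃ₗ[ℝ] StrongDual ℝ N).toLinearMap

lemma zero_mem_normBall {r : ℝ} (hr : 0 ≤ r) : (0 : WeakDual ℝ N) ∈ normBall N r := by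
  simpa [mem_normBall] using hr

lemma isCompact_normBall (r : ℝ) : IsCompact (normBall N r) := isCompact_closedBall 0 r

lemma isPeanoSpace_normBall [TopologicalSpace.SeparableSpace N] {r : ℝ} (hr : 0 ≤ r) :
    IsPeanoSpace (normBall N r) := by
  have hne : (normBall N r).Nonempty := ⟨0, zero_mem_normBall hr⟩
  have : LocallyConvexSpace ℝ (WeakDual ℝ N) :=
    inferInstanceAs (LocallyConvexSpace ℝ (WeakBilin (topDualPairing ℝ N)))
  have : LocallyPathConnectedSpace (normBall N r) := (convex_normBall r).locallyPathConnectedSpace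
  exact ⟨hne.to_subtype, isCompact_iff_compactSpace.1 (isCompact_normBall r),
    isConnected_iff_connectedSpace.1 ((convex_normBall r).isConnected hne), inferInstance,
    metrizable_of_isCompact ℝ N _ (isCompact_normBall r)⟩

/-- The dual unit ball of a separable normed space is a continuous image of the Hilbert cube. -/
lemma exists_continuous_surjective_cube_normBall [TopologicalSpace.SeparableSpace N] :
    ∃ P : (ℕ → unitInterval) → normBall N 1, Continuous P ∧ Function.Surjective P := by
  have : CompactSpace (normBall N 1) := isCompact_iff_compactSpace.1 (isCompact_normBall 1)
  have : Nonempty (normBall N 1) := ⟨0, zero_mem_normBall zero_le_one⟩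
  let d := TopologicalSpace.denseSeq N
  have hpos : ∀ i, 0 < 1 + ‖d i‖ := fun i ↦ by positivity
  refine exists_continuous_surjective_of_midpoints
    (b := fun i (x : normBall N 1) ↦ (1 + (x : WeakDual ℝ N) (d i) / (1 + ‖d i‖)) / 2)
    (fun i ↦ ?_) (fun i x ↦ ?_) (fun x y h ↦ ?_) (fun x y ↦ ?_)
  · have := (eval_continuous (𝕜 := ℝ) (d i)).comp (continuous_subtype_val (p := (· ∈ normBall N 1)))
    exact (continuous_const.add (this.div_const _)).div_const _
  · have h1 : |(x : WeakDual ℝ N) (d i)| ≤ 1 * ‖d i‖ :=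
      (toStrongDual (x : WeakDual ℝ N)).le_of_opNorm_le (mem_normBall.1 x.2) (d i)
    have h2 : |(x : WeakDual ℝ N) (d i) / (1 + ‖d i‖)| ≤ 1 := by
      rw [abs_div, abs_of_pos (hpos i), div_le_one (hpos i)]
      linarith
    rw [abs_le] at h2
    constructor <;> linarith [h2.1, h2.2]
  · refine Subtype.ext (DFunLike.ext' ?_)
    refine (map_continuous (x : WeakDual ℝ N)).ext_on (TopologicalSpace.denseRange_denseSeq N)
      (map_continuous (y : WeakDual ℝ N)) (eqOn_range.2 (funext fun i ↦ ?_))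
    have := h i
    have hi := (hpos i).ne'
    field_simp at this
    simpa [d] using this
  · refine ⟨⟨(1 / 2 : ℝ) • (x : WeakDual ℝ N) + (1 / 2 : ℝ) • (y : WeakDual ℝ N),
      convex_normBall 1 x.2 y.2 (by norm_num) (by norm_num) (by norm_num)⟩, fun i ↦ ?_⟩
    have : ((1 / 2 : ℝ) • (x : WeakDual ℝ N) + (1 / 2 : ℝ) • (y : WeakDual ℝ N)) (d i) =
      1 / 2 * (x : WeakDual ℝ N) (d i) + 1 / 2 * (y : WeakDual ℝ N) (d i) := rfl
    simp only [this]
    ring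

end WeakDual

theorem stmt10 (N : Type*) [NormedAddCommGroup N] [NormedSpace ℝ N]
    [TopologicalSpace.SeparableSpace N] :
    (∃ f : ℝ → WeakDual ℝ N, Continuous f ∧ Function.Surjective f) ∧
      IsSigmaPeano (WeakDual ℝ N) := by
  constructor
  · obtain ⟨P, hPc, hPs⟩ := WeakDual.exists_continuous_surjective_cube_normBall (N := N)
    obtain ⟨g, hgc, hgs⟩ := exists_continuous_curve_real_prod_cube
    refine ⟨fun t ↦ (g t).1 • (P (g t).2 : WeakDual ℝ N), by fun_prop, fun x ↦ ?_⟩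
    obtain ⟨n, hn⟩ := exists_nat_gt ‖WeakDual.toStrongDual x‖
    have hn0 : (0 : ℝ) < n := (norm_nonneg _).trans_lt hn
    have hx : (n : ℝ)⁻¹ • x ∈ WeakDual.normBall N 1 := by
      rw [WeakDual.mem_normBall, map_smul, norm_smul, norm_inv, Real.norm_of_nonneg hn0.le,
        inv_mul_le_one₀ hn0]
      exact hn.le
    obtain ⟨q, hq⟩ := hPs ⟨_, hx⟩
    obtain ⟨t, ht⟩ := hgs n q
    exact ⟨t, by simp [ht, hq, smul_smul, hn0.ne']⟩
  · refine ⟨fun n ↦ WeakDual.normBall N n, fun m n hmn x hx ↦ ?_,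
      fun n ↦ WeakDual.isPeanoSpace_normBall n.cast_nonneg, eq_univ_of_forall fun x ↦ ?_⟩
    · exact WeakDual.mem_normBall.2 ((WeakDual.mem_normBall.1 hx).trans (Nat.cast_le.2 hmn))
    · obtain ⟨n, hn⟩ := exists_nat_ge ‖WeakDual.toStrongDual x‖
      exact mem_iUnion.2 ⟨n, WeakDual.mem_normBall.2 hn⟩
end

section
/- The space c₀₀ of eventually null real sequences endowed with the supremum norm is a σ-Peano space; in particular, there exists a continuous surjection from ℝ onto c₀₀. -/
open scoped ENNReal

/-- `c₀₀`: the subspace of `ℓ^∞` consisting of eventually null real sequences,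
endowed (as a submodule of `ℓ^∞`) with the supremum norm. -/
noncomputable def c00 : Submodule ℝ (lp (fun _ : ℕ => ℝ) ∞) where
  carrier := {x | ∃ N : ℕ, ∀ n ≥ N, (x : ℕ → ℝ) n = 0}
  add_mem' := by
    rintro x y ⟨N, hN⟩ ⟨M, hM⟩
    refine ⟨max N M, fun n hn => ?_⟩
    have hx := hN n (le_trans (le_max_left _ _) hn)
    have hy := hM n (le_trans (le_max_right _ _) hn)
    simp [lp.coeFn_add, hx, hy]
  zero_mem' := ⟨0, fun n _ => by simp⟩
  smul_mem' := by
    rintro c x ⟨N, hN⟩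
    refine ⟨N, fun n hn => ?_⟩
    simp [lp.coeFn_smul, hN n hn]


/-- A nonempty compact convex subset of a real normed space is a Peano space. -/
theorem isPeanoSpace_of_isCompact_of_convex {E : Type*} [NormedAddCommGroup E] [NormedSpace ℝ E]
    {K : Set E} (hne : K.Nonempty) (hK : IsCompact K) (hc : Convex ℝ K) : IsPeanoSpace K := by
  refine ⟨hne.to_subtype, isCompact_iff_compactSpace.1 hK,
    isConnected_iff_connectedSpace.1 ⟨hne, hc.isPreconnected⟩, ?_, inferInstance⟩
  refine locallyConnectedSpace_of_connected_bases (fun x r => Metric.ball x r) (fun _ r => 0 < r)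
    (fun _ => Metric.nhds_basis_ball) fun x r _ => ?_
  rw [← Topology.IsInducing.subtypeVal.isPreconnected_image]
  have h : (Subtype.val '' Metric.ball x r : Set E) = Metric.ball (x : E) r ∩ K := by
    ext y
    simp only [Set.mem_image, Metric.mem_ball, Subtype.exists, Subtype.dist_eq, Set.mem_inter_iff]
    grind
  rw [h]
  exact ((convex_ball _ _).inter hc).isPreconnected

/-- Every nonempty compact set in a metrizable space with the Tietze extension property is covered
by the image of the unit interval under a continuous map from `ℝ`. -/
theorem exists_continuous_subset_image_Icc {Y : Type} [TopologicalSpace Y]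
    [TopologicalSpace.MetrizableSpace Y] [TietzeExtension.{0, 0} Y] {K : Set Y}
    (hne : K.Nonempty) (hK : IsCompact K) :
    ∃ g : C(ℝ, Y), K ⊆ g '' Set.Icc 0 1 := by
  let := TopologicalSpace.metrizableSpaceMetric K
  have := hne.to_subtype
  have := isCompact_iff_compactSpace.1 hK
  obtain ⟨f, hf, hfs⟩ := exists_nat_bool_continuous_surjective_of_compact K
  let e := cantorSetHomeomorphNatToBool
  obtain ⟨g, hg⟩ := ContinuousMap.exists_restrict_eq isClosed_cantorSet
    ⟨fun x : cantorSet => (f (e x) : Y), by fun_prop⟩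
  refine ⟨g, fun y hy => ?_⟩
  obtain ⟨z, hz⟩ := hfs ⟨y, hy⟩
  refine ⟨e.symm z, cantorSet_subset_unitInterval (e.symm z).2, ?_⟩
  simpa [hz] using DFunLike.congr_fun hg (e.symm z)

/-- If countably many continuous images of the unit interval cover a real topological vector space,
then that space is a continuous image of the real line. -/
theorem exists_continuous_surjective_of_iUnion_image_Icc {E : Type*} [AddCommGroup E] [Module ℝ E]
    [TopologicalSpace E] [ContinuousAdd E] [ContinuousSMul ℝ E] {g : ℕ → ℝ → E}
    (hg : ∀ n, Continuous (g n)) (hcover : ⋃ n, g n '' Set.Icc 0 1 = Set.univ) :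
    ∃ f : ℝ → E, Continuous f ∧ Function.Surjective f := by
  let φ : ℝ → ℝ := fun s => max 0 (min 1 (2 - |s|))
  have hφ : Continuous φ := by fun_prop
  have hφ_one : ∀ s, |s| ≤ 1 → φ s = 1 := fun s hs => by grind
  have hφ_zero : ∀ s, 2 ≤ |s| → φ s = 0 := fun s hs => by grind
  refine ⟨fun t => ∑ᶠ n : ℕ, φ (t - 4 * n) • g n (t - 4 * n), ?_, fun x => ?_⟩
  · refine continuous_finsum (fun n => by have := hg n; fun_prop) fun t => ?_
    refine ⟨Metric.ball t 1, Metric.ball_mem_nhds t one_pos,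
      (Set.finite_Iic ⌈|t| + 3⌉₊).subset ?_⟩
    rintro n ⟨s, hs, hst⟩
    have hsn : |s - 4 * n| < 2 := by
      by_contra! h
      exact hs (by simp [hφ_zero _ h])
    rw [Metric.mem_ball, Real.dist_eq] at hst
    have hn : (n : ℝ) ≤ |t| + 3 := by grind [Nat.cast_nonneg (α := ℝ) n]
    exact_mod_cast hn.trans (Nat.le_ceil _)
  · obtain ⟨n, t, ⟨ht0, ht1⟩, rfl⟩ := Set.mem_iUnion.1 (hcover.symm ▸ Set.mem_univ x)
    refine ⟨t + 4 * n, ?_⟩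
    dsimp only
    rw [finsum_eq_single _ n]
    · rw [add_sub_cancel_right, hφ_one t (by grind), one_smul]
    · intro m hm
      rw [hφ_zero, zero_smul]
      rcases lt_or_gt_of_ne hm with h | h
      · have : (m : ℝ) + 1 ≤ n := by exact_mod_cast h
        grind
      · have : (n : ℝ) + 1 ≤ m := by exact_mod_cast h
        grind

namespace c00

/-- The standard unit vectors of `c00`. -/
noncomputable def unitVec (i : ℕ) : c00 :=
  ⟨lp.single ∞ i 1, i + 1, fun n hn => lp.single_apply_ne _ _ _ (by omega)⟩

/-- The linear map sending a real sequence to its truncation to the first `n` coordinates. -/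
noncomputable def truncate (n : ℕ) : (ℕ → ℝ) →ₗ[ℝ] c00 :=
  ∑ i ∈ Finset.range n, (LinearMap.proj i).smulRight (unitVec i)

theorem truncate_eq_sum (n : ℕ) (x : ℕ → ℝ) :
    truncate n x = ∑ i ∈ Finset.range n, x i • unitVec i := by
  simp [truncate]

theorem continuous_truncate (n : ℕ) : Continuous (truncate n) := by
  rw [funext (truncate_eq_sum n)]
  exact continuous_finsetSum _ fun i _ => (continuous_apply i).smul continuous_const

theorem truncate_apply (n : ℕ) (x : ℕ → ℝ) (i : ℕ) :
    (truncate n x : lp (fun _ : ℕ => ℝ) ∞) i = if i < n then x i else 0 := by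
  rw [truncate_eq_sum, Submodule.coe_sum, lp.coeFn_sum, Finset.sum_apply]
  simp [unitVec, Pi.single_apply]

theorem ext {x y : c00} (h : ∀ i, (x : lp (fun _ : ℕ => ℝ) ∞) i = (y : lp (fun _ : ℕ => ℝ) ∞) i) :
    x = y :=
  Subtype.ext (lp.ext (funext h))

/-- The cube `[-n, n]^ℕ` of real sequences. -/
def cube (n : ℕ) : Set (ℕ → ℝ) := Set.univ.pi fun _ => Set.Icc (-n : ℝ) n

theorem mem_cube {n : ℕ} {x : ℕ → ℝ} : x ∈ cube n ↔ ∀ i, |x i| ≤ n := by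
  simp [cube, Set.mem_pi, abs_le, -Set.pi_univ_Icc]

theorem cube_nonempty (n : ℕ) : (cube n).Nonempty := ⟨0, mem_cube.2 (by simp)⟩

theorem isCompact_cube (n : ℕ) : IsCompact (cube n) :=
  isCompact_univ_pi fun _ => isCompact_Icc

theorem convex_cube (n : ℕ) : Convex ℝ (cube n) :=
  convex_pi fun _ _ => convex_Icc _ _

theorem monotone_truncate_image_cube : Monotone fun n => truncate n '' cube n := by
  rintro n m hnm _ ⟨x, hx, rfl⟩
  rw [mem_cube] at hx
  have hnm' : (n : ℝ) ≤ m := by exact_mod_cast hnm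
  refine ⟨fun i => if i < n then x i else 0, mem_cube.2 fun i => ?_, ext fun i => ?_⟩
  · split_ifs
    · exact (hx i).trans hnm'
    · simp
  · simp only [truncate_apply]
    grind

theorem iUnion_truncate_image_cube : ⋃ n, truncate n '' cube n = Set.univ := by
  refine Set.eq_univ_of_forall fun x => Set.mem_iUnion.2 ?_
  obtain ⟨N, hN⟩ := x.2
  refine ⟨max N ⌈‖x‖⌉₊, (x : lp (fun _ : ℕ => ℝ) ∞), mem_cube.2 fun i => ?_, ext fun i => ?_⟩
  · have h : |(x : lp (fun _ : ℕ => ℝ) ∞) i| ≤ ‖x‖ := lp.norm_apply_le_norm ENNReal.top_ne_zero x.1 i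
    exact h.trans ((Nat.le_ceil _).trans (by exact_mod_cast le_max_right _ _))
  · rw [truncate_apply]
    split_ifs with h
    · rfl
    · exact (hN i (by omega)).symm

end c00

theorem stmt15 :
    IsSigmaPeano c00 ∧ ∃ f : ℝ → c00, Continuous f ∧ Function.Surjective f := by
  refine ⟨⟨fun n => c00.truncate n '' c00.cube n, c00.monotone_truncate_image_cube, fun n => ?_,
    c00.iUnion_truncate_image_cube⟩, ?_⟩
  · exact isPeanoSpace_of_isCompact_of_convex ((c00.cube_nonempty n).image _)
      ((c00.isCompact_cube n).image (c00.continuous_truncate n))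
      ((c00.convex_cube n).linear_image _)
  · choose g hg using fun n =>
      exists_continuous_subset_image_Icc (c00.cube_nonempty n) (c00.isCompact_cube n)
    refine exists_continuous_surjective_of_iUnion_image_Icc
      (fun n => (c00.continuous_truncate n).comp (g n).continuous) ?_
    refine Set.eq_univ_of_univ_subset (c00.iUnion_truncate_image_cube.symm.subset.trans ?_)
    refine Set.iUnion_mono fun n => ?_
    rw [Set.image_comp]
    exact Set.image_mono (hg n)
end

section
/- Let c₀₀(ℂ) denote the space of eventually null complex sequences endowed with the supremum norm, and let m ∈ ℕ, m ≥ 1. Then CS_∞(ℝ^m, c₀₀(ℂ)) is strongly 𝔠-algebrable in C(ℝ^m, c₀₀(ℂ)): there exists a family (g_i)_{i∈I} of continuous maps ℝ^m → c₀₀(ℂ), indexed by a set I of cardinality 𝔠 (the continuum), such that for every N ∈ ℕ, every choice of distinct indices i₁, …, i_N ∈ I, and every nonzero polynomial P ∈ ℂ[z₁,…,z_N] with zero constant term, the map x ↦ P(g_{i₁}(x),…,g_{i_N}(x)) (with addition, scalar multiplication and multiplication on c₀₀(ℂ) taken coordinatewise) belongs to CS_∞(ℝ^m, c₀₀(ℂ));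 in particular it is not identically zero. -/
open scoped ENNReal

/-- `c₀₀(ℂ)`: the subspace of complex `ℓ^∞` consisting of eventually null complex
sequences, endowed (as a submodule of `ℓ^∞`) with the supremum norm. -/
noncomputable def c00C : Submodule ℂ (lp (fun _ : ℕ => ℂ) ∞) where
  carrier := {x | ∃ N : ℕ, ∀ n ≥ N, (x : ℕ → ℂ) n = 0}
  add_mem' := by
    rintro x y ⟨N, hN⟩ ⟨M, hM⟩
    refine ⟨max N M, fun n hn => ?_⟩
    have hx := hN n (le_trans (le_max_left _ _) hn)
    have hy := hM n (le_trans (le_max_right _ _) hn)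
    simp [lp.coeFn_add, hx, hy]
  zero_mem' := ⟨0, fun n _ => by simp⟩
  smul_mem' := by
    rintro c x ⟨N, hN⟩
    refine ⟨N, fun n hn => ?_⟩
    simp [lp.coeFn_smul, hN n hn]

/-- `CSInf m X f` means `f : ℝ^m → X` is continuous and each fiber `f⁻¹({a})` is an
unbounded subset of `ℝ^m`; in particular such an `f` is surjective. -/
def CSInf (m : ℕ) (X : Type*) [TopologicalSpace X]
    (f : EuclideanSpace ℝ (Fin m) → X) : Prop :=
  Continuous f ∧ ∀ a : X, ¬ Bornology.IsBounded (f ⁻¹' {a})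

/-- A continuous compactly supported curve filling a ball of a finite-dimensional complex space. -/
theorem exists_continuous_curve_fill_closedBall (κ : Type) [Fintype κ] (R : ℝ) :
    ∃ γ : ℝ → κ → ℂ, Continuous γ ∧ (∀ t, t ∉ Set.Icc (-1 : ℝ) 2 → γ t = 0) ∧
      ∀ v : κ → ℂ, ‖v‖ ≤ R → ∃ t ∈ Set.Icc (0 : ℝ) 1, γ t = v := by
  rcases lt_or_ge R 0 with hR | hR
  · exact ⟨0, continuous_const, fun _ _ => rfl,
      fun v hv => absurd (norm_nonneg v) (by linarith)⟩
  have : Nonempty (Metric.closedBall (0 : κ → ℂ) R) := ⟨⟨0, by simpa using hR⟩⟩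
  have : CompactSpace (Metric.closedBall (0 : κ → ℂ) R) :=
    isCompact_iff_compactSpace.mp (isCompact_closedBall _ _)
  obtain ⟨σ, hσ, hsurj⟩ :=
    exists_nat_bool_continuous_surjective_of_compact (Metric.closedBall (0 : κ → ℂ) R)
  obtain ⟨γ, hγ⟩ := ContinuousMap.exists_restrict_eq isClosed_cantorSet
    (⟨fun x => (σ (cantorSetHomeomorphNatToBool x) : κ → ℂ), by fun_prop⟩ : C(cantorSet, κ → ℂ))
  let φ : ℝ → ℝ := fun t => max 0 (min 1 (min (t + 1) (2 - t)))
  refine ⟨fun t => (φ t : ℂ) • γ t, by fun_prop, fun t ht => ?_, fun v hv => ?_⟩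
  · have hφ : φ t = 0 := by
      refine max_eq_left ?_
      by_contra! hpos
      simp only [lt_min_iff] at hpos
      exact ht ⟨by linarith, by linarith⟩
    simp [hφ]
  · obtain ⟨b, hb⟩ := hsurj ⟨v, by simpa using hv⟩
    set x := cantorSetHomeomorphNatToBool.symm b with hx
    have hx01 := cantorSet_subset_unitInterval x.2
    refine ⟨x, hx01, ?_⟩
    have hφ : φ x = 1 := by
      have h1 : (1 : ℝ) ≤ x + 1 := by linarith [hx01.1]
      have h2 : (1 : ℝ) ≤ 2 - x := by linarith [hx01.2]
      simp [φ, h1, h2]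
    have hγx : γ x = v := by
      have := DFunLike.congr_fun hγ x
      simpa [hx, hb] using this
    simp [hφ, hγx]

/-- A nonzero complex polynomial without constant term takes every value. -/
theorem MvPolynomial.exists_eval_eq_of_coeff_zero {σ : Type*} {P : MvPolynomial σ ℂ}
    (hP : P ≠ 0) (h0 : MvPolynomial.coeff 0 P = 0) (a : ℂ) : ∃ w, MvPolynomial.eval w P = a := by
  obtain ⟨w, hw⟩ : ∃ w, MvPolynomial.eval w P ≠ 0 := by
    by_contra! h
    exact hP (MvPolynomial.funext fun x => by simpa using h x)
  let q : Polynomial ℂ := MvPolynomial.aeval (fun k => Polynomial.C (w k) * Polynomial.X) P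
  have hq (s : ℂ) : q.eval s = MvPolynomial.eval (fun k => w k * s) P := by
    have := MvPolynomial.eval₂_comp_left (Polynomial.evalRingHom s) (algebraMap ℂ (Polynomial ℂ))
      (fun k => Polynomial.C (w k) * Polynomial.X) P
    simp only [q, MvPolynomial.aeval_def]
    rw [← Polynomial.coe_evalRingHom, this, MvPolynomial.eval, MvPolynomial.coe_eval₂Hom]
    congr 1 <;> ext <;> simp
  have hdeg : (q - Polynomial.C a).degree ≠ 0 := by
    intro hd
    have hc := Polynomial.eq_C_of_degree_eq_zero hd
    have heq : q.eval 1 = q.eval 0 := by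
      have h1 := congrArg (Polynomial.eval 1) hc
      have h2 := congrArg (Polynomial.eval 0) hc
      simp only [Polynomial.eval_sub, Polynomial.eval_C] at h1 h2
      linear_combination h1 - h2
    rw [hq, hq] at heq
    apply hw
    simpa [MvPolynomial.constantCoeff_eq, h0, ← Pi.zero_def] using heq
  obtain ⟨s, hs⟩ := IsAlgClosed.exists_root _ hdeg
  refine ⟨fun k => w k * s, ?_⟩
  rw [← hq]
  simpa [sub_eq_zero] using hs

theorem lp.infty_aeval_apply {σ : Type*} (u : σ → lp (fun _ : ℕ => ℂ) ∞) (P : MvPolynomial σ ℂ)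
    (j : ℕ) : (MvPolynomial.aeval u P : ℕ → ℂ) j =
      MvPolynomial.eval (fun k => (u k : ℕ → ℂ) j) P := by
  induction P using MvPolynomial.induction_on with
  | C a =>
    rw [MvPolynomial.aeval_C, MvPolynomial.eval_C, Algebra.algebraMap_eq_smul_one]
    simp [lp.coeFn_smul, lp.infty_coeFn_one]
  | add p q hp hq => simp [hp, hq]
  | mul_X p k hp => simp [lp.infty_coeFn_mul, hp]

theorem continuous_aeval_of_continuous {X A σ : Type*} [TopologicalSpace X] [CommRing A]
    [Algebra ℂ A] [TopologicalSpace A] [IsTopologicalRing A] {u : σ → X → A}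
    (hu : ∀ k, Continuous (u k)) (P : MvPolynomial σ ℂ) :
    Continuous fun x => MvPolynomial.aeval (fun k => u k x) P := by
  induction P using MvPolynomial.induction_on with
  | C a => simpa using continuous_const
  | add p q hp hq => simp only [map_add]; fun_prop
  | mul_X p k hp =>
    simp only [map_mul, MvPolynomial.aeval_X]
    exact hp.fun_mul (hu k)

/-- The sequence supported on `{j}` with value `1` at `j`. -/
noncomputable def c00CBasis (j : ℕ) : c00C :=
  ⟨lp.single ∞ j (1 : ℂ), j + 1, fun n hn => by
    simp [lp.single_apply, show n ≠ j by omega]⟩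

/-- The eventually null sequence with the given first `n` entries. -/
noncomputable def c00COfFin {n : ℕ} (w : Fin n → ℂ) : c00C :=
  ∑ j, w j • c00CBasis j

theorem continuous_c00COfFin (n : ℕ) : Continuous (c00COfFin (n := n)) := by
  have : ContinuousAdd c00C := c00C.continuousAdd
  exact continuous_finsetSum _ fun j _ => (continuous_apply j).smul continuous_const

theorem c00COfFin_zero (n : ℕ) : c00COfFin (0 : Fin n → ℂ) = 0 := by
  simp [c00COfFin]

theorem c00COfFin_apply {n : ℕ} (w : ℕ → ℂ) (hw : ∀ j ≥ n, w j = 0) (j : ℕ) :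
    ((c00COfFin (fun i : Fin n => w i) : lp (fun _ : ℕ => ℂ) ∞) : ℕ → ℂ) j = w j := by
  have h : ((c00COfFin (fun i : Fin n => w i) : lp (fun _ : ℕ => ℂ) ∞) : ℕ → ℂ) j =
      ∑ i ∈ Finset.range n, if i = j then w i else 0 := by
    rw [Finset.sum_range]
    simp only [c00COfFin, c00CBasis, Submodule.coe_sum, Submodule.coe_smul, lp.coeFn_sum,
      Finset.sum_apply, lp.coeFn_smul, Pi.smul_apply, lp.single_apply]
    refine Finset.sum_congr rfl fun i _ => ?_
    rcases eq_or_ne (i : ℕ) j with hij | hij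
    · subst hij; simp
    · simp [hij, hij.symm]
  rw [h, Finset.sum_ite_eq']
  split_ifs with hj
  · rfl
  · exact (hw j (by simpa using hj)).symm

/-- Distinct binary sequences have distinct initial segments from some length on. -/
theorem exists_forall_ge_injective_restrict {α : Type*} [Finite α] {idx : α → ℕ → Bool}
    (h : Function.Injective idx) :
    ∃ n₀, ∀ n ≥ n₀, Function.Injective fun k (i : Fin n) => idx k i := by
  have key (k l : α) : ∃ d, k ≠ l → idx k d ≠ idx l d := by
    by_cases hkl : k = l
    · exact ⟨0, fun h => absurd hkl h⟩
    · obtain ⟨d, hd⟩ := Function.ne_iff.mp (h.ne hkl)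
      exact ⟨d, fun _ => hd⟩
  choose d hd using key
  obtain ⟨B, hB⟩ := (Set.finite_range fun p : α × α => d p.1 p.2).bddAbove
  refine ⟨B + 1, fun n hn k l hkl => ?_⟩
  by_contra hne
  have hlt : d k l < n := by
    have := hB ⟨(k, l), rfl⟩
    dsimp only at this
    omega
  exact hd k l hne (congrFun hkl ⟨d k l, hlt⟩)

/-- There is a family of curves in `c₀₀(ℂ)` indexed by binary sequences such that finitely many
of them simultaneously take any prescribed values at arbitrarily large times. -/
theorem exists_jointly_surjective_curves :
    ∃ g : (ℕ → Bool) → ℝ → c00C, (∀ i, Continuous (g i)) ∧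
      ∀ (N : ℕ) (idx : Fin N → ℕ → Bool), Function.Injective idx →
        ∀ (w : Fin N → ℕ → ℂ) (M : ℕ), (∀ k, ∀ j ≥ M, w k j = 0) → ∀ T : ℝ, ∃ t ≥ T, ∀ k j,
          ((g (idx k) t : lp (fun _ : ℕ => ℂ) ∞) : ℕ → ℂ) j = w k j := by
  choose γ hγc hγ0 hγs using
    fun n : ℕ => exists_continuous_curve_fill_closedBall ((Fin n → Bool) × Fin n) n
  have : ContinuousAdd c00C := c00C.continuousAdd
  let G (i : ℕ → Bool) (n : ℕ) (t : ℝ) : c00C :=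
    c00COfFin fun j => γ n (t - 4 * n) (fun l => i l, j)
  have hG0 (i) (n : ℕ) (t : ℝ) (ht : t - 4 * n ∉ Set.Icc (-1 : ℝ) 2) : G i n t = 0 := by
    simp only [G, hγ0 n _ ht]
    exact c00COfFin_zero n
  have hGc (i n) : Continuous (G i n) := by
    refine (continuous_c00COfFin n).comp ?_
    have := hγc n
    fun_prop
  refine ⟨fun i t => ∑ᶠ n, G i n t, fun i => continuous_finsum (hGc i) fun x => ?_, ?_⟩
  · refine ⟨Metric.ball x 1, Metric.ball_mem_nhds x one_pos,
      (Set.finite_Iic ⌈x + 2⌉₊).subset ?_⟩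
    rintro n ⟨t, ht, htx⟩
    have h1 : t - 4 * n ∈ Set.Icc (-1 : ℝ) 2 := by
      by_contra hcon
      exact ht (hG0 i n t hcon)
    rw [Metric.mem_ball, Real.dist_eq, abs_lt] at htx
    have h2 := Nat.le_ceil (x + 2)
    have h3 : (0 : ℝ) ≤ n := n.cast_nonneg
    have : (n : ℝ) ≤ ⌈x + 2⌉₊ := by linarith [h1.1, htx.2]
    exact_mod_cast this
  · intro N idx hidx w M hw T
    obtain ⟨n₀, hn₀⟩ := exists_forall_ge_injective_restrict hidx
    obtain ⟨B, hB⟩ := (Set.finite_range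
      fun p : Fin N × Fin M => ‖w p.1 p.2‖).bddAbove
    have hwB (k j) : ‖w k j‖ ≤ max B 0 := by
      by_cases hj : j < M
      · exact le_max_of_le_left (hB ⟨(k, ⟨j, hj⟩), rfl⟩)
      · simp [hw k j (by omega)]
    let n := max (max n₀ M) (max ⌈max B 0⌉₊ ⌈T⌉₊)
    have hnM : M ≤ n := by simp [n]
    have hnB : max B 0 ≤ n := (Nat.le_ceil _).trans (Nat.cast_le.mpr (by simp [n]))
    have hnT : T ≤ n := (Nat.le_ceil _).trans (Nat.cast_le.mpr (by simp [n]))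
    have hinj := hn₀ n (by simp [n])
    let v : (Fin n → Bool) × Fin n → ℂ := fun p =>
      Function.extend (fun k (i : Fin n) => idx k i) (fun k => w k p.2) 0 p.1
    have hv (k : Fin N) (j : Fin n) : v (fun l => idx k l, j) = w k j :=
      hinj.extend_apply (fun k => w k j) 0 k
    have hvn : ‖v‖ ≤ n := by
      refine (pi_norm_le_iff_of_nonneg n.cast_nonneg).mpr fun ⟨c, j⟩ => ?_
      by_cases hc : ∃ k, (fun i : Fin n => idx k i) = c
      · obtain ⟨k, rfl⟩ := hc
        rw [hv]
        exact (hwB k j).trans hnB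
      · simp [v, Function.extend_apply' _ _ _ hc]
    obtain ⟨s, hs, hγv⟩ := hγs n v hvn
    have hn0 : (0 : ℝ) ≤ n := n.cast_nonneg
    refine ⟨4 * n + s, by linarith [hs.1], fun k j => ?_⟩
    have hsum : ∑ᶠ n', G (idx k) n' (4 * n + s) = G (idx k) n (4 * n + s) := by
      refine finsum_eq_single _ _ fun n' hn' => hG0 _ _ _ fun hmem => hn' ?_
      have h1 : (n : ℝ) < n' + 1 := by linarith [hmem.2, hs.1]
      have h2 : (n' : ℝ) < n + 1 := by linarith [hmem.1, hs.2]
      norm_cast at h1 h2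
      omega
    have hGw : G (idx k) n (4 * n + s) = c00COfFin fun j : Fin n => w k j := by
      simp only [G, add_sub_cancel_left, hγv, hv]
    dsimp only
    rw [hsum, hGw]
    exact c00COfFin_apply (w k) (fun j hj => hw k j (hnM.trans hj)) j

theorem stmt16 (m : ℕ) (hm : 1 ≤ m) :
    ∃ (ι : Type) (g : ι → EuclideanSpace ℝ (Fin m) → c00C),
      Cardinal.mk ι = Cardinal.continuum ∧
      (∀ i, Continuous (g i)) ∧
      ∀ (N : ℕ) (idx : Fin N → ι), Function.Injective idx →
        ∀ P : MvPolynomial (Fin N) ℂ, P ≠ 0 → MvPolynomial.coeff 0 P = 0 →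
          ∃ h : EuclideanSpace ℝ (Fin m) → c00C,
            (∀ x j, ((h x : lp (fun _ : ℕ => ℂ) ∞) : ℕ → ℂ) j =
                MvPolynomial.eval
                  (fun k => ((g (idx k) x : lp (fun _ : ℕ => ℂ) ∞) : ℕ → ℂ) j) P) ∧
            CSInf m c00C h := by
  obtain ⟨g, hgc, hg⟩ := exists_jointly_surjective_curves
  let z : Fin m := ⟨0, hm⟩
  refine ⟨ℕ → Bool, fun i x => g i (x z), by simp, fun i => (hgc i).comp (by fun_prop), ?_⟩
  intro N idx hidx P hP hP0
  have hPzero : MvPolynomial.eval (fun _ => (0 : ℂ)) P = 0 := by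
    simpa [MvPolynomial.constantCoeff_eq, ← Pi.zero_def] using hP0
  let u (k : Fin N) (x : EuclideanSpace ℝ (Fin m)) : lp (fun _ : ℕ => ℂ) ∞ := g (idx k) (x z)
  have hmem (x) : MvPolynomial.aeval (fun k => u k x) P ∈ c00C := by
    choose M hM using fun k => (g (idx k) (x z)).2
    refine ⟨Finset.univ.sup M, fun n hn => ?_⟩
    rw [lp.infty_aeval_apply, ← hPzero]
    congr 2
    ext k
    exact hM k n ((Finset.le_sup (Finset.mem_univ k)).trans hn)
  refine ⟨fun x => ⟨_, hmem x⟩, fun x j => lp.infty_aeval_apply _ P j, ?_, fun a hbdd => ?_⟩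
  · refine (continuous_aeval_of_continuous (fun k => ?_) P).subtype_mk hmem
    exact continuous_subtype_val.comp ((hgc (idx k)).comp (by fun_prop))
  · obtain ⟨M, hM⟩ := a.2
    choose y hy using MvPolynomial.exists_eval_eq_of_coeff_zero hP hP0
    let w (k : Fin N) (j : ℕ) : ℂ := if j < M then y ((a : lp (fun _ : ℕ => ℂ) ∞) j) k else 0
    obtain ⟨C, hC⟩ := hbdd.exists_norm_le
    obtain ⟨t, htC, ht⟩ := hg N idx hidx w M (fun k j hj => if_neg (by omega)) (C + 1)
    have hx : EuclideanSpace.single z t ∈ (fun x => (⟨_, hmem x⟩ : c00C)) ⁻¹' {a} := by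
      refine Subtype.ext (lp.ext (funext fun j => ?_))
      refine (lp.infty_aeval_apply _ P j).trans ?_
      have hu (k : Fin N) : (u k (EuclideanSpace.single z t) : ℕ → ℂ) j = w k j := by
        simpa [u] using ht k j
      simp only [hu, w]
      by_cases hj : j < M
      · simpa [hj] using hy _
      · simpa only [hj, if_false, hPzero] using (hM j (by omega)).symm
    have := hC _ hx
    rw [PiLp.norm_single, Real.norm_eq_abs] at this
    linarith [le_abs_self t]
end
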